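/- Let H be a complex inner product space, let Ω ∈ H be a unit vector, and let P₁, P₂ be orthogonal projections on H. Write α_i = arccos(‖P_iΩ‖) ∈ [0, π/2] for i = 1, 2, and suppose cos²(α₁) + cos²(α₂) > 1 (so that α₁ + α₂ < π/2). Then ‖P₂P₁Ω‖² ≥ cos²(α₁)·cos²(α₁ + α₂). -/

import Mathlib

open scoped ComplexInnerProductSpace

/-- The component orthogonal to the unit vector `Ω` of a vector `x` with `⟪Ω, x⟫ = ‖x‖ ^ 2`. -/
lemma norm_sub_norm_sq_smul_sq {H : Type*} [NormedAddCommGroup H] [InnerProductSpace ℂ H]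
    {Ω x : H} (hΩ : ‖Ω‖ = 1) (hx : ⟪Ω, x⟫ = ((‖x‖ ^ 2 : ℝ) : ℂ)) :
    ‖x - ((‖x‖ ^ 2 : ℝ) : ℂ) • Ω‖ ^ 2 = ‖x‖ ^ 2 * (1 - ‖x‖ ^ 2) := by
  have hx' : ⟪x, Ω⟫ = ((‖x‖ ^ 2 : ℝ) : ℂ) := by
    rw [← inner_conj_symm, hx, Complex.conj_ofReal]
  rw [@norm_sub_sq ℂ, inner_smul_right, hx', norm_smul, hΩ, Complex.norm_real,
    Real.norm_of_nonneg (sq_nonneg _), ← Complex.ofReal_mul, RCLike.re_to_complex,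
    Complex.ofReal_re]
  ring

/-- Two vectors in the relation `⟪Ω, x⟫ = ‖x‖ ^ 2` to a unit vector `Ω` satisfy the triangle
inequality for their angles to `Ω`. -/
lemma norm_mul_norm_mul_cos_add_arccos_le_norm_inner {H : Type*} [NormedAddCommGroup H]
    [InnerProductSpace ℂ H] {Ω x y : H} (hΩ : ‖Ω‖ = 1)
    (hx : ⟪Ω, x⟫ = ((‖x‖ ^ 2 : ℝ) : ℂ)) (hy : ⟪Ω, y⟫ = ((‖y‖ ^ 2 : ℝ) : ℂ))
    (hx1 : ‖x‖ ≤ 1) (hy1 : ‖y‖ ≤ 1) :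
    ‖x‖ * ‖y‖ * Real.cos (Real.arccos ‖x‖ + Real.arccos ‖y‖) ≤ ‖⟪x, y⟫‖ := by
  have norm_eq : ∀ z : H, ⟪Ω, z⟫ = ((‖z‖ ^ 2 : ℝ) : ℂ) → ‖z‖ ≤ 1 →
      ‖z - ((‖z‖ ^ 2 : ℝ) : ℂ) • Ω‖ = ‖z‖ * Real.sqrt (1 - ‖z‖ ^ 2) := by
    intro z hz hz1
    have h1 : 0 ≤ 1 - ‖z‖ ^ 2 := by nlinarith [norm_nonneg z]
    rw [← sq_eq_sq₀ (norm_nonneg _) (by positivity), norm_sub_norm_sq_smul_sq hΩ hz, mul_pow,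
      Real.sq_sqrt h1]
  have hx' : ⟪x, Ω⟫ = ((‖x‖ ^ 2 : ℝ) : ℂ) := by
    rw [← inner_conj_symm, hx, Complex.conj_ofReal]
  have inner_eq : ⟪x - ((‖x‖ ^ 2 : ℝ) : ℂ) • Ω, y - ((‖y‖ ^ 2 : ℝ) : ℂ) • Ω⟫ =
      ⟪x, y⟫ - ((‖x‖ ^ 2 * ‖y‖ ^ 2 : ℝ) : ℂ) := by
    rw [inner_sub_left, inner_sub_right, inner_sub_right, inner_smul_left, inner_smul_left,
      inner_smul_right, inner_smul_right, hx', hy, inner_self_eq_norm_sq_to_K, hΩ,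
      Complex.conj_ofReal]
    push_cast
    ring
  have cauchy := norm_inner_le_norm (𝕜 := ℂ)
    (x - ((‖x‖ ^ 2 : ℝ) : ℂ) • Ω) (y - ((‖y‖ ^ 2 : ℝ) : ℂ) • Ω)
  rw [inner_eq, norm_eq x hx hx1, norm_eq y hy hy1] at cauchy
  have tri := norm_sub_norm_le ((‖x‖ ^ 2 * ‖y‖ ^ 2 : ℝ) : ℂ) ⟪x, y⟫
  rw [norm_sub_rev, Complex.norm_real, Real.norm_of_nonneg (by positivity)] at tri
  rw [Real.cos_add, Real.cos_arccos (by linarith [norm_nonneg x]) hx1,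
    Real.cos_arccos (by linarith [norm_nonneg y]) hy1, Real.sin_arccos, Real.sin_arccos]
  linarith

lemma inner_apply_eq_norm_sq_of_idempotent_of_symmetric {H : Type*} [NormedAddCommGroup H]
    [InnerProductSpace ℂ H] {P : H →L[ℂ] H} (hidem : P ∘L P = P)
    (hsa : ∀ x y : H, ⟪P x, y⟫ = ⟪x, P y⟫) (x : H) : ⟪x, P x⟫ = ((‖P x‖ ^ 2 : ℝ) : ℂ) := by
  have h : P (P x) = P x := DFunLike.congr_fun hidem x
  rw [← h, ← hsa, h, inner_self_eq_norm_sq_to_K]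
  push_cast
  rfl

lemma norm_apply_le_of_idempotent_of_symmetric {H : Type*} [NormedAddCommGroup H]
    [InnerProductSpace ℂ H] {P : H →L[ℂ] H} (hidem : P ∘L P = P)
    (hsa : ∀ x y : H, ⟪P x, y⟫ = ⟪x, P y⟫) (x : H) : ‖P x‖ ≤ ‖x‖ := by
  have h := norm_inner_le_norm (𝕜 := ℂ) x (P x)
  rw [inner_apply_eq_norm_sq_of_idempotent_of_symmetric hidem hsa, Complex.norm_real,
    Real.norm_of_nonneg (sq_nonneg _)] at h
  nlinarith [norm_nonneg x, norm_nonneg (P x)]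

theorem stmt_6 {H : Type*} [NormedAddCommGroup H] [InnerProductSpace ℂ H]
    (Ω : H) (hΩ : ‖Ω‖ = 1)
    (P₁ P₂ : H →L[ℂ] H)
    (h₁idem : P₁ ∘L P₁ = P₁) (h₁sa : ∀ x y : H, ⟪P₁ x, y⟫ = ⟪x, P₁ y⟫)
    (h₂idem : P₂ ∘L P₂ = P₂) (h₂sa : ∀ x y : H, ⟪P₂ x, y⟫ = ⟪x, P₂ y⟫)
    (α₁ α₂ : ℝ)
    (hα₁ : α₁ = Real.arccos ‖P₁ Ω‖) (hα₂ : α₂ = Real.arccos ‖P₂ Ω‖)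
    (hgt : Real.cos α₁ ^ 2 + Real.cos α₂ ^ 2 > 1) :
    ‖P₂ (P₁ Ω)‖ ^ 2 ≥ Real.cos α₁ ^ 2 * Real.cos (α₁ + α₂) ^ 2 := by
  have h1 : ‖P₁ Ω‖ ≤ 1 := hΩ ▸ norm_apply_le_of_idempotent_of_symmetric h₁idem h₁sa Ω
  have h2 : ‖P₂ Ω‖ ≤ 1 := hΩ ▸ norm_apply_le_of_idempotent_of_symmetric h₂idem h₂sa Ω
  have hc1 : Real.cos α₁ = ‖P₁ Ω‖ := by
    rw [hα₁, Real.cos_arccos (by linarith [norm_nonneg (P₁ Ω)]) h1]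
  have hc2 : Real.cos α₂ = ‖P₂ Ω‖ := by
    rw [hα₂, Real.cos_arccos (by linarith [norm_nonneg (P₂ Ω)]) h2]
  have angle := norm_mul_norm_mul_cos_add_arccos_le_norm_inner hΩ
    (inner_apply_eq_norm_sq_of_idempotent_of_symmetric h₁idem h₁sa Ω)
    (inner_apply_eq_norm_sq_of_idempotent_of_symmetric h₂idem h₂sa Ω) h1 h2
  rw [← hα₁, ← hα₂] at angle
  have hP : ⟪P₁ Ω, P₂ Ω⟫ = ⟪P₂ (P₁ Ω), P₂ Ω⟫ := by
    rw [h₂sa, show P₂ (P₂ Ω) = P₂ Ω from DFunLike.congr_fun h₂idem Ω]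
  have cauchy := norm_inner_le_norm (𝕜 := ℂ) (P₂ (P₁ Ω)) (P₂ Ω)
  rw [← hP] at cauchy
  have hpos : 0 < ‖P₂ Ω‖ := by
    refine (norm_nonneg _).lt_of_ne fun h ↦ ?_
    rw [hc1, hc2, ← h] at hgt
    nlinarith [norm_nonneg (P₁ Ω)]
  have key : ‖P₁ Ω‖ * Real.cos (α₁ + α₂) ≤ ‖P₂ (P₁ Ω)‖ :=
    le_of_mul_le_mul_right (by linarith) hpos
  have hcos : 0 ≤ Real.cos (α₁ + α₂) := by
    have hs1 : 0 ≤ Real.sin α₁ := by rw [hα₁, Real.sin_arccos]; positivity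
    have hs2 : 0 ≤ Real.sin α₂ := by rw [hα₂, Real.sin_arccos]; positivity
    have hsc1 : Real.sin α₁ ≤ Real.cos α₂ :=
      le_of_abs_le (abs_le_of_sq_le_sq (by linarith [Real.sin_sq_add_cos_sq α₁])
        (by rw [hc2]; positivity))
    have hsc2 : Real.sin α₂ ≤ Real.cos α₁ :=
      le_of_abs_le (abs_le_of_sq_le_sq (by linarith [Real.sin_sq_add_cos_sq α₂])
        (by rw [hc1]; positivity))
    have := mul_le_mul hsc1 hsc2 hs2 (hs1.trans hsc1)
    rw [Real.cos_add]
    linarith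
  rw [hc1, ← mul_pow]
  exact pow_le_pow_left₀ (by positivity) key 2
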